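/- Fix 0 < α < 1 and a ≥ 2^α(2+α)/(1−α). There is a constant c > 0, independent of the β's, such that for every f ∈ C₂, every ε > 0, every n ≥ 1, and every sequence β₁, …, β_n ∈ (0, α], one has ‖(P_{β_n} ∘ ⋯ ∘ P_{β_1})(A_ε f) − (P_{β_n} ∘ ⋯ ∘ P_{β_1}) f‖_{L¹(m)} ≤ c ‖f‖_{L¹(m)} ε^{1−α}. -/

import Mathlib

open MeasureTheory Set

/-- The Pomeau–Manneville type map `T_β` on `[0,1]` (identified with the circle `S¹`):
`T_β x = x + 3^β/2^(1+β) x^(1+β)` for `x ≤ 2/3` and `T_β x = 3x - 2` otherwise. -/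
noncomputable def Tmap (β x : ℝ) : ℝ :=
  if x ≤ 2/3 then x + (3:ℝ)^β / 2^(1+β) * x^(1+β) else 3*x - 2

/-- The derivative of `T_β` (left-branch formula at `x ≤ 2/3`). -/
noncomputable def Tderiv (β x : ℝ) : ℝ :=
  if x ≤ 2/3 then 1 + (3:ℝ)^β / 2^(1+β) * (1+β) * x^β else 3

/-- The second derivative of `T_β`. -/
noncomputable def Tderiv2 (β x : ℝ) : ℝ :=
  if x ≤ 2/3 then (3:ℝ)^β / 2^(1+β) * (1+β) * β * x^(β-1) else 0

/-- The inverse of the left branch of `T_β` (for `x ∈ [0,1]` this is the unique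
`y ∈ [0,2/3]` with `T_β y = x`). -/
noncomputable def leftInv (β x : ℝ) : ℝ :=
  sSup {y : ℝ | y ∈ Set.Icc (0:ℝ) (2/3) ∧ Tmap β y ≤ x}

/-- The Perron–Frobenius transfer operator of `T_β` with respect to Lebesgue measure:
`P_β f (x) = ∑_{y ∈ T_β⁻¹ x} f y / T_β' y`; the right branch preimage of `x` is `(x+2)/3`,
where the derivative is `3`. -/
noncomputable def Pop (β : ℝ) (f : ℝ → ℝ) (x : ℝ) : ℝ :=
  f (leftInv β x) / Tderiv β (leftInv β x) + f ((x+2)/3) / 3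

/-- `P_{β_{k+n}} ∘ ⋯ ∘ P_{β_{k+1}}`. -/
noncomputable def PopCompFrom (β : ℕ → ℝ) (k : ℕ) : ℕ → (ℝ → ℝ) → ℝ → ℝ
  | 0, f => f
  | n+1, f => Pop (β (k+n+1)) (PopCompFrom β k n f)

/-- `P_{β_n} ∘ ⋯ ∘ P_{β_1}`. -/
noncomputable def PopComp (β : ℕ → ℝ) (n : ℕ) : (ℝ → ℝ) → ℝ → ℝ :=
  PopCompFrom β 0 n

/-- `T_{β_{k+n}} ∘ ⋯ ∘ T_{β_{k+1}}`. -/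
noncomputable def TcompFrom (β : ℕ → ℝ) (k : ℕ) : ℕ → ℝ → ℝ
  | 0, x => x
  | n+1, x => Tmap (β (k+n+1)) (TcompFrom β k n x)

/-- The derivative `(T_{β_{k+n}} ∘ ⋯ ∘ T_{β_{k+1}})'(z)`, computed as the product of the
derivatives along the orbit of `z`. -/
noncomputable def DcompFrom (β : ℕ → ℝ) (k n : ℕ) (z : ℝ) : ℝ :=
  ∏ i ∈ Finset.range n, Tderiv (β (k+i+1)) (TcompFrom β k i z)

/-- The averaging operator `A_ε f (x) = (1/(2ε)) ∫_{B_ε(x)} f dm` on the circle,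
realized via the 1-periodic extension of `f`. -/
noncomputable def Aop (ε : ℝ) (f : ℝ → ℝ) (x : ℝ) : ℝ :=
  (1/(2*ε)) * ∫ t in (x-ε)..(x+ε), f (Int.fract t)

/-- The indicator function of the ball `B_ε(z)` of radius `ε` around `z` in the circle `ℝ/ℤ`. -/
noncomputable def ballInd (ε z : ℝ) : ℝ → ℝ :=
  Set.indicator {y : ℝ | ∃ k : ℤ, |y - z - (k:ℝ)| < ε} (fun _ => 1)

/-- The cone `C₁ = {f ∈ C⁰((0,1]) : f ≥ 0, f decreasing, x ↦ x^(α+1) f x increasing}`. -/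
def memC1 (α : ℝ) (f : ℝ → ℝ) : Prop :=
  ContinuousOn f (Set.Ioc 0 1) ∧ (∀ x ∈ Set.Ioc (0:ℝ) 1, 0 ≤ f x) ∧
  AntitoneOn f (Set.Ioc 0 1) ∧ MonotoneOn (fun x : ℝ => x^(α+1) * f x) (Set.Ioc 0 1)

/-- `m(f) = ∫₀¹ f dm` (Lebesgue). -/
noncomputable def mInt (f : ℝ → ℝ) : ℝ := ∫ x in Set.Ioc (0:ℝ) 1, f x

/-- The cone `C₂ = {f ∈ C₁ ∩ L¹(m) : f x ≤ a x^(-α) m(f)}`. -/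
def memC2 (α a : ℝ) (f : ℝ → ℝ) : Prop :=
  memC1 α f ∧ IntegrableOn f (Set.Ioc 0 1) volume ∧
  ∀ x ∈ Set.Ioc (0:ℝ) 1, f x ≤ a * x^(-α) * mInt f

/-- The `L¹(m)` norm on `[0,1]`. -/
noncomputable def L1norm (f : ℝ → ℝ) : ℝ := ∫ x in Set.Ioc (0:ℝ) 1, |f x|

/-- The `C¹` norm `‖f‖_∞ + ‖f'‖_∞` on the circle. -/
noncomputable def C1norm (f : ℝ → ℝ) : ℝ :=
  (⨆ x : Set.Icc (0:ℝ) 1, |f (x:ℝ)|) + ⨆ x : Set.Icc (0:ℝ) 1, |deriv f (x:ℝ)|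

/-- The coefficient of the nonlinear term of `Tmap` is positive. -/
lemma Tmap_coeff_pos (β : ℝ) : 0 < (3:ℝ)^β / 2^(1+β) := by positivity

lemma Tmap_strictMonoOn {β : ℝ} (hβ : 0 < β) :
    StrictMonoOn (Tmap β) (Icc 0 (2/3)) := by
  intro x hx y hy hxy
  have h : x^(1+β) ≤ y^(1+β) := Real.rpow_le_rpow hx.1 hxy.le (by linarith)
  have := mul_le_mul_of_nonneg_left h (Tmap_coeff_pos β).le
  simp only [Tmap, if_pos hx.2, if_pos hy.2]
  linarith

lemma Tmap_continuousOn {β : ℝ} (hβ : 0 < β) :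
    ContinuousOn (Tmap β) (Icc 0 (2/3)) := by
  have h : ContinuousOn (fun x : ℝ => x + (3:ℝ)^β / 2^(1+β) * x^(1+β)) (Icc 0 (2/3)) := by
    have : Continuous (fun x : ℝ => x^(1+β)) := Real.continuous_rpow_const (by linarith)
    fun_prop
  exact h.congr fun x hx => by simp only [Tmap, if_pos hx.2]

lemma Tmap_zero {β : ℝ} (hβ : 0 < β) : Tmap β 0 = 0 := by
  rw [Tmap, if_pos (by norm_num), Real.zero_rpow (by linarith)]
  simp

lemma Tmap_two_thirds (β : ℝ) : Tmap β (2/3) = 1 := by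
  rw [Tmap, if_pos le_rfl, Real.div_rpow (by norm_num) (by norm_num),
    Real.rpow_add (by norm_num) 1 β, Real.rpow_add (by norm_num) 1 β]
  have h2 : (2:ℝ)^β ≠ 0 := by positivity
  have h3 : (3:ℝ)^β ≠ 0 := by positivity
  simp only [Real.rpow_one]
  field_simp
  norm_num

lemma Tmap_image_left {β : ℝ} (hβ : 0 < β) : Tmap β '' Ioc 0 (2/3) = Ioc 0 1 := by
  have hm := Tmap_strictMonoOn hβ
  have h0 : (0:ℝ) ∈ Icc (0:ℝ) (2/3) := by constructor <;> norm_num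
  have h1 : (2/3:ℝ) ∈ Icc (0:ℝ) (2/3) := by constructor <;> norm_num
  ext x
  constructor
  · rintro ⟨y, hy, rfl⟩
    refine ⟨?_, ?_⟩
    · rw [← Tmap_zero hβ]
      exact hm h0 ⟨hy.1.le, hy.2⟩ hy.1
    · rw [← Tmap_two_thirds β]
      exact hm.monotoneOn ⟨hy.1.le, hy.2⟩ h1 hy.2
  · intro hx
    have := intermediate_value_Icc (by norm_num : (0:ℝ) ≤ 2/3) (Tmap_continuousOn hβ)
    rw [Tmap_zero hβ, Tmap_two_thirds] at this
    obtain ⟨y, hy, rfl⟩ := this ⟨hx.1.le, hx.2⟩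
    refine ⟨y, ⟨lt_of_le_of_ne hy.1 ?_, hy.2⟩, rfl⟩
    rintro rfl
    rw [Tmap_zero hβ] at hx
    exact lt_irrefl _ hx.1

lemma leftInv_Tmap {β y : ℝ} (hβ : 0 < β) (hy : y ∈ Icc (0:ℝ) (2/3)) :
    leftInv β (Tmap β y) = y := by
  have : {z : ℝ | z ∈ Icc (0:ℝ) (2/3) ∧ Tmap β z ≤ Tmap β y} = Icc 0 y := by
    ext z
    constructor
    · rintro ⟨hz, h⟩
      exact ⟨hz.1, ((Tmap_strictMonoOn hβ).le_iff_le hz hy).1 h⟩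
    · intro hz
      have hz' : z ∈ Icc (0:ℝ) (2/3) := ⟨hz.1, hz.2.trans hy.2⟩
      exact ⟨hz', ((Tmap_strictMonoOn hβ).le_iff_le hz' hy).2 hz.2⟩
  rw [leftInv, this, csSup_Icc hy.1]

lemma leftInv_mem {β x : ℝ} (hβ : 0 < β) (hx : x ∈ Ioc (0:ℝ) 1) :
    leftInv β x ∈ Ioc (0:ℝ) (2/3) := by
  rw [← Tmap_image_left hβ] at hx
  obtain ⟨y, hy, rfl⟩ := hx
  rwa [leftInv_Tmap hβ ⟨hy.1.le, hy.2⟩]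

lemma Tderiv_pos {β y : ℝ} (hβ : 0 < β) (hy : 0 ≤ y) : 0 < Tderiv β y := by
  unfold Tderiv
  split_ifs <;> positivity

lemma Tmap_hasDerivWithinAt {β y : ℝ} (hy : y ∈ Ioc (0:ℝ) (2/3)) :
    HasDerivWithinAt (Tmap β) (Tderiv β y) (Ioc 0 (2/3)) y := by
  have h : HasDerivAt (fun x : ℝ => x + (3:ℝ)^β / 2^(1+β) * x^(1+β))
      (1 + (3:ℝ)^β / 2^(1+β) * ((1+β) * y^(1+β-1))) y :=
    (hasDerivAt_id y).add
      ((Real.hasDerivAt_rpow_const (Or.inl hy.1.ne')).const_mul _)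
  have h' : Tderiv β y = 1 + (3:ℝ)^β / 2^(1+β) * ((1+β) * y^(1+β-1)) := by
    rw [Tderiv, if_pos hy.2, add_sub_cancel_left]
    ring
  rw [h']
  exact h.hasDerivWithinAt.congr (fun x hx => by simp only [Tmap, if_pos hx.2])
    (by simp only [Tmap, if_pos hy.2])

lemma Tmap_injOn {β : ℝ} (hβ : 0 < β) : InjOn (Tmap β) (Ioc 0 (2/3)) :=
  (Tmap_strictMonoOn hβ).injOn.mono Ioc_subset_Icc_self

/-- The change of variables along the left branch. -/
lemma abs_Tderiv_smul_leftInv {β y : ℝ} (hβ : 0 < β) (hy : y ∈ Ioc (0:ℝ) (2/3)) (g : ℝ → ℝ) :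
    |Tderiv β y| • (g (leftInv β (Tmap β y)) / Tderiv β (leftInv β (Tmap β y))) = g y := by
  have := Tderiv_pos hβ hy.1.le
  rw [leftInv_Tmap hβ ⟨hy.1.le, hy.2⟩, abs_of_pos this, smul_eq_mul]
  field_simp

lemma integrableOn_left_branch {β : ℝ} (hβ : 0 < β) {g : ℝ → ℝ}
    (hg : IntegrableOn g (Ioc 0 (2/3))) :
    IntegrableOn (fun x => g (leftInv β x) / Tderiv β (leftInv β x)) (Ioc 0 1) := by
  rw [← Tmap_image_left hβ, integrableOn_image_iff_integrableOn_abs_deriv_smul measurableSet_Ioc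
    (fun x hx => Tmap_hasDerivWithinAt hx) (Tmap_injOn hβ)]
  exact hg.congr_fun (fun y hy => (abs_Tderiv_smul_leftInv hβ hy g).symm) measurableSet_Ioc

lemma integral_left_branch {β : ℝ} (hβ : 0 < β) (g : ℝ → ℝ) :
    ∫ x in Ioc (0:ℝ) 1, g (leftInv β x) / Tderiv β (leftInv β x)
      = ∫ x in Ioc (0:ℝ) (2/3), g x := by
  rw [← Tmap_image_left hβ, integral_image_eq_integral_abs_deriv_smul measurableSet_Ioc
    (fun x hx => Tmap_hasDerivWithinAt hx) (Tmap_injOn hβ)]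
  exact setIntegral_congr_fun measurableSet_Ioc fun y hy => abs_Tderiv_smul_leftInv hβ hy g

lemma right_branch_image : (fun x : ℝ => 3 * x - 2) '' Ioc (2/3) 1 = Ioc 0 1 := by
  ext x
  constructor
  · rintro ⟨y, hy, rfl⟩
    constructor <;> dsimp only <;> linarith [hy.1, hy.2]
  · intro hx
    exact ⟨(x+2)/3, ⟨by linarith [hx.1], by linarith [hx.2]⟩, by dsimp only; ring⟩

lemma right_branch_hasDerivWithinAt (s : Set ℝ) (y : ℝ) :
    HasDerivWithinAt (fun x : ℝ => 3 * x - 2) 3 s y := by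
  simpa using (((hasDerivAt_id y).const_mul 3).sub_const 2).hasDerivWithinAt

lemma right_branch_injOn (s : Set ℝ) : InjOn (fun x : ℝ => 3 * x - 2) s :=
  fun x _ y _ h => by dsimp only at h; linarith

lemma abs_three_smul_right_branch (g : ℝ → ℝ) (y : ℝ) :
    |(3:ℝ)| • (g ((3 * y - 2 + 2) / 3) / 3) = g y := by
  have : (3 * y - 2 + 2) / 3 = y := by ring
  rw [this, abs_of_pos (by norm_num), smul_eq_mul]
  ring

lemma integrableOn_right_branch {g : ℝ → ℝ} (hg : IntegrableOn g (Ioc (2/3) 1)) :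
    IntegrableOn (fun x => g ((x+2)/3) / 3) (Ioc 0 1) := by
  rw [← right_branch_image, integrableOn_image_iff_integrableOn_abs_deriv_smul measurableSet_Ioc
    (fun x _ => right_branch_hasDerivWithinAt _ x) (right_branch_injOn _)]
  exact hg.congr_fun (fun y _ => (abs_three_smul_right_branch g y).symm) measurableSet_Ioc

lemma integral_right_branch (g : ℝ → ℝ) :
    ∫ x in Ioc (0:ℝ) 1, g ((x+2)/3) / 3 = ∫ x in Ioc (2/3:ℝ) 1, g x := by
  rw [← right_branch_image, integral_image_eq_integral_abs_deriv_smul measurableSet_Ioc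
    (fun x _ => right_branch_hasDerivWithinAt _ x) (right_branch_injOn _)]
  exact setIntegral_congr_fun measurableSet_Ioc fun y _ => abs_three_smul_right_branch g y

lemma Pop_integrableOn {β : ℝ} (hβ : 0 < β) {g : ℝ → ℝ} (hg : IntegrableOn g (Ioc 0 1)) :
    IntegrableOn (Pop β g) (Ioc 0 1) :=
  (integrableOn_left_branch hβ (hg.mono_set (Ioc_subset_Ioc_right (by norm_num)))).add
    (integrableOn_right_branch (hg.mono_set (Ioc_subset_Ioc_left (by norm_num))))

/-- The transfer operator contracts the `L¹` norm. -/
lemma L1norm_Pop_le {β : ℝ} (hβ : 0 < β) {g : ℝ → ℝ} (hg : IntegrableOn g (Ioc 0 1)) :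
    L1norm (Pop β g) ≤ L1norm g := by
  have hl : IntegrableOn (fun x => |g x|) (Ioc 0 (2/3)) :=
    (hg.mono_set (Ioc_subset_Ioc_right (by norm_num))).abs
  have hr : IntegrableOn (fun x => |g x|) (Ioc (2/3) 1) :=
    (hg.mono_set (Ioc_subset_Ioc_left (by norm_num))).abs
  have hl' := integrableOn_left_branch hβ hl
  have hr' := integrableOn_right_branch hr
  unfold L1norm
  calc ∫ x in Ioc (0:ℝ) 1, |Pop β g x|
      ≤ ∫ x in Ioc (0:ℝ) 1, (|g (leftInv β x)| / Tderiv β (leftInv β x)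
          + |g ((x+2)/3)| / 3) := by
        refine setIntegral_mono_on (Pop_integrableOn hβ hg).abs (hl'.add hr')
          measurableSet_Ioc fun x hx => ?_
        refine (abs_add_le _ _).trans (le_of_eq ?_)
        rw [abs_div, abs_div, abs_of_pos (Tderiv_pos hβ (leftInv_mem hβ hx).1.le),
          abs_of_pos (by norm_num : (0:ℝ) < 3)]
    _ = ∫ x in Ioc (0:ℝ) 1, |g x| := by
        rw [integral_add hl' hr', integral_left_branch hβ (fun x => |g x|),
          integral_right_branch (fun x => |g x|), ← setIntegral_union
            (Ioc_disjoint_Ioc_of_le le_rfl) measurableSet_Ioc hl hr,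
          Ioc_union_Ioc_eq_Ioc (by norm_num) (by norm_num)]

lemma PopComp_succ (β : ℕ → ℝ) (n : ℕ) (f : ℝ → ℝ) :
    PopComp β (n+1) f = Pop (β (n+1)) (PopComp β n f) := by
  simp [PopComp, PopCompFrom]

lemma PopComp_sub (β : ℕ → ℝ) (n : ℕ) (f g : ℝ → ℝ) :
    PopComp β n (fun x => f x - g x) = fun x => PopComp β n f x - PopComp β n g x := by
  induction n with
  | zero => rfl
  | succ n ih =>
    funext x
    simp only [PopComp_succ, ih, Pop]
    ring

lemma PopComp_L1 {β : ℕ → ℝ} {n : ℕ} (hβ : ∀ i, 1 ≤ i → i ≤ n → 0 < β i) {g : ℝ → ℝ}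
    (hg : IntegrableOn g (Ioc 0 1)) :
    IntegrableOn (PopComp β n g) (Ioc 0 1) ∧ L1norm (PopComp β n g) ≤ L1norm g := by
  induction n with
  | zero => exact ⟨hg, le_rfl⟩
  | succ n ih =>
    obtain ⟨h1, h2⟩ := ih fun i hi hin => hβ i hi (by omega)
    have h := hβ (n+1) (by omega) le_rfl
    rw [PopComp_succ]
    exact ⟨Pop_integrableOn h h1, (L1norm_Pop_le h h1).trans h2⟩

/-- The `1`-periodic extension of `f` restricted to `(0,1)`, vanishing at the integers. -/
noncomputable def perExt (f : ℝ → ℝ) (x : ℝ) : ℝ :=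
  (Ioc (0:ℝ) 1).indicator f (Int.fract x)

lemma perExt_periodic (f : ℝ → ℝ) : Function.Periodic (perExt f) 1 := fun x => by
  simp [perExt]

lemma perExt_of_mem_Ioo (f : ℝ → ℝ) {x : ℝ} (hx : x ∈ Ioo (0:ℝ) 1) : perExt f x = f x := by
  rw [perExt, Int.fract_eq_self.2 ⟨hx.1.le, hx.2⟩, indicator_of_mem (Ioo_subset_Ioc_self hx)]

lemma perExt_nonneg {f : ℝ → ℝ} (hf : ∀ x ∈ Ioc (0:ℝ) 1, 0 ≤ f x) (x : ℝ) : 0 ≤ perExt f x :=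
  indicator_nonneg hf _

lemma perExt_measurable {f : ℝ → ℝ} (hf : ContinuousOn f (Ioc 0 1)) : Measurable (perExt f) := by
  classical
  have : Measurable ((Ioc (0:ℝ) 1).indicator f) := by
    rw [← piecewise_eq_indicator]
    exact hf.measurable_piecewise continuousOn_const measurableSet_Ioc
  exact this.comp measurable_fract

lemma perExt_intervalIntegrable {f : ℝ → ℝ} (hf : IntegrableOn f (Ioc 0 1)) (u v : ℝ) :
    IntervalIntegrable (perExt f) volume u v := by
  refine (perExt_periodic f).intervalIntegrable one_ne_zero (t := 0) ?_ u v
  rw [zero_add, intervalIntegrable_iff_integrableOn_Ioo_of_le zero_le_one]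
  exact (hf.mono_set Ioo_subset_Ioc_self).congr_fun
    (fun x hx => (perExt_of_mem_Ioo f hx).symm) measurableSet_Ioo

lemma perExt_intervalIntegrable_add {f : ℝ → ℝ} (hf : IntegrableOn f (Ioc 0 1)) (s u v : ℝ) :
    IntervalIntegrable (fun x => perExt f (x + s)) volume u v := by
  simpa using (perExt_intervalIntegrable hf (u + s) (v + s)).comp_add_right s

lemma Aop_eq_perExt (ε : ℝ) (f : ℝ → ℝ) (x : ℝ) :
    Aop ε f x = (1/(2*ε)) * ∫ t in (x-ε)..(x+ε), perExt f t := by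
  have h : ∀ᵐ t : ℝ, t ∉ range ((↑) : ℤ → ℝ) := (countable_range _).ae_notMem _
  rw [Aop]
  congr 1
  refine intervalIntegral.integral_congr_ae ?_
  filter_upwards [h] with t ht _
  have h0 : Int.fract t ≠ 0 := fun h0 => ht (by
    obtain ⟨z, hz⟩ := Int.fract_eq_zero_iff.1 h0
    exact ⟨z, hz⟩)
  rw [perExt, indicator_of_mem]
  exact ⟨lt_of_le_of_ne (Int.fract_nonneg t) h0.symm, (Int.fract_lt_one t).le⟩

lemma Aop_continuous {f : ℝ → ℝ} (hf : IntegrableOn f (Ioc 0 1)) (ε : ℝ) :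
    Continuous (Aop ε f) := by
  have hi := perExt_intervalIntegrable hf
  have hc := intervalIntegral.continuous_primitive hi 0
  have : Aop ε f = fun x => (1/(2*ε)) *
      ((∫ t in (0:ℝ)..(x+ε), perExt f t) - ∫ t in (0:ℝ)..(x-ε), perExt f t) := by
    funext x
    rw [Aop_eq_perExt, intervalIntegral.integral_interval_sub_left (hi _ _) (hi _ _)]
  rw [this]
  exact continuous_const.mul ((hc.comp (by fun_prop : Continuous fun x : ℝ => x + ε)).sub
    (hc.comp (by fun_prop : Continuous fun x : ℝ => x - ε)))

lemma Aop_sub_eq {f : ℝ → ℝ} (hf : IntegrableOn f (Ioc 0 1)) {ε : ℝ} (hε : 0 < ε) {x : ℝ}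
    (hx : x ∈ Ioo (0:ℝ) 1) :
    Aop ε f x - f x = (1/(2*ε)) * ∫ s in (-ε)..ε, (perExt f (x + s) - perExt f x) := by
  have hi : IntervalIntegrable (fun s => perExt f (x + s)) volume (-ε) ε := by
    simpa only [add_comm] using perExt_intervalIntegrable_add hf x (-ε) ε
  rw [intervalIntegral.integral_sub hi intervalIntegrable_const,
    intervalIntegral.integral_comp_add_left (fun t => perExt f t), Aop_eq_perExt,
    intervalIntegral.integral_const, perExt_of_mem_Ioo f hx, smul_eq_mul, ← sub_eq_add_neg]
  field_simp
  ring

/-- The `L¹` modulus of continuity, on the circle, of a decreasing function on `(0,1]`. -/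
lemma integral_abs_shift_le {f : ℝ → ℝ} (hf : IntegrableOn f (Ioc 0 1))
    (h0 : ∀ x ∈ Ioc (0:ℝ) 1, 0 ≤ f x) (hanti : AntitoneOn f (Ioc 0 1))
    {s : ℝ} (hs0 : 0 ≤ s) (hs1 : s ≤ 1) :
    ∫ x in (0:ℝ)..1, |perExt f (x + s) - perExt f x| ≤ 2 * ∫ x in (0:ℝ)..s, perExt f x := by
  have hG := perExt_intervalIntegrable hf
  have hGs := perExt_intervalIntegrable_add hf s
  have hD : ∀ u v, IntervalIntegrable (fun x => perExt f (x + s) - perExt f x) volume u v :=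
    fun u v => (hGs u v).sub (hG u v)
  have hDa : ∀ u v, IntervalIntegrable (fun x => |perExt f (x + s) - perExt f x|) volume u v :=
    fun u v => (hD u v).abs
  have hzero : ∫ x in (0:ℝ)..1, (perExt f (x + s) - perExt f x) = 0 := by
    rw [intervalIntegral.integral_sub (hGs _ _) (hG _ _),
      intervalIntegral.integral_comp_add_right (fun t => perExt f t), sub_eq_zero, zero_add,
      add_comm 1 s, (perExt_periodic f).intervalIntegral_add_eq s 0, zero_add]
  have hleft : ∫ x in (0:ℝ)..(1-s), |perExt f (x + s) - perExt f x|
      ≤ ∫ x in (0:ℝ)..(1-s), -(perExt f (x + s) - perExt f x) := by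
    refine intervalIntegral.integral_mono_on_of_le_Ioo (by linarith) (hDa _ _) (hD _ _).neg
      fun x hx => le_of_eq (abs_of_nonpos ?_)
    have hx1 : x ∈ Ioo (0:ℝ) 1 := ⟨hx.1, by linarith [hx.2]⟩
    have hx2 : x + s ∈ Ioo (0:ℝ) 1 := ⟨by linarith [hx.1], by linarith [hx.2]⟩
    rw [perExt_of_mem_Ioo f hx1, perExt_of_mem_Ioo f hx2]
    linarith [hanti (Ioo_subset_Ioc_self hx1) (Ioo_subset_Ioc_self hx2) (by linarith)]
  have hright : ∫ x in (1-s)..1, |perExt f (x + s) - perExt f x|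
      ≤ ∫ x in (1-s)..1, (2 * perExt f (x + s) - (perExt f (x + s) - perExt f x)) := by
    refine intervalIntegral.integral_mono_on (by linarith) (hDa _ _)
      (((hGs _ _).const_mul 2).sub (hD _ _)) fun x _ => ?_
    have h1 := perExt_nonneg h0 x
    have h2 := perExt_nonneg h0 (x + s)
    rw [abs_le]
    constructor <;> linarith
  have hper : ∫ x in (1-s)..1, perExt f (x + s) = ∫ x in (0:ℝ)..s, perExt f x := by
    have h := intervalIntegral.integral_comp_add_right (a := 0) (b := s) (fun t => perExt f t) 1
    simp only [perExt_periodic f _] at h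
    rw [intervalIntegral.integral_comp_add_right (fun t => perExt f t), h]
    congr 1 <;> ring
  rw [intervalIntegral.integral_neg] at hleft
  rw [intervalIntegral.integral_sub ((hGs _ _).const_mul 2) (hD _ _),
    intervalIntegral.integral_const_mul, hper] at hright
  rw [← intervalIntegral.integral_add_adjacent_intervals (hD 0 (1-s)) (hD (1-s) 1)] at hzero
  rw [← intervalIntegral.integral_add_adjacent_intervals (hDa 0 (1-s)) (hDa (1-s) 1)]
  linarith

lemma integral_perExt_le {f : ℝ → ℝ} (hf : IntegrableOn f (Ioc 0 1)) {α K : ℝ} (hα1 : α < 1)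
    (hK : ∀ x ∈ Ioc (0:ℝ) 1, f x ≤ K * x^(-α)) {s : ℝ} (hs0 : 0 ≤ s) (hs1 : s ≤ 1) :
    ∫ x in (0:ℝ)..s, perExt f x ≤ K / (1-α) * s^(1-α) := by
  have hint : IntervalIntegrable (fun x : ℝ => x^(-α)) volume 0 s :=
    intervalIntegral.intervalIntegrable_rpow' (by linarith)
  calc ∫ x in (0:ℝ)..s, perExt f x ≤ ∫ x in (0:ℝ)..s, K * x^(-α) := by
        refine intervalIntegral.integral_mono_on_of_le_Ioo hs0
          (perExt_intervalIntegrable hf _ _) (hint.const_mul K) fun x hx => ?_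
        have hx' : x ∈ Ioo (0:ℝ) 1 := ⟨hx.1, hx.2.trans_le hs1⟩
        rw [perExt_of_mem_Ioo f hx']
        exact hK x (Ioo_subset_Ioc_self hx')
    _ = K / (1-α) * s^(1-α) := by
        rw [intervalIntegral.integral_const_mul, integral_rpow (Or.inl (by linarith)),
          neg_add_eq_sub, Real.zero_rpow (by linarith)]
        ring

lemma integral_abs_shift_le_rpow_of_nonneg {f : ℝ → ℝ} (hf : IntegrableOn f (Ioc 0 1))
    (h0 : ∀ x ∈ Ioc (0:ℝ) 1, 0 ≤ f x) (hanti : AntitoneOn f (Ioc 0 1))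
    {α K : ℝ} (hα1 : α < 1) (hK0 : 0 ≤ K) (hK : ∀ x ∈ Ioc (0:ℝ) 1, f x ≤ K * x^(-α))
    {s : ℝ} (hs0 : 0 ≤ s) :
    ∫ x in (0:ℝ)..1, |perExt f (x + s) - perExt f x| ≤ 2 * (K / (1-α) * s^(1-α)) := by
  have hfr0 := Int.fract_nonneg s
  have hfr1 := (Int.fract_lt_one s).le
  have hshift : ∀ x, perExt f (x + s) = perExt f (x + Int.fract s) := fun x => by
    have h := (perExt_periodic f).int_mul ⌊s⌋ (x + Int.fract s)
    rw [mul_one, add_assoc, Int.fract_add_floor] at h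
    exact h
  have hle : Int.fract s ≤ s := by
    have : (0:ℝ) ≤ ⌊s⌋ := by exact_mod_cast Int.floor_nonneg.2 hs0
    rw [Int.fract]
    linarith
  simp only [hshift]
  calc ∫ x in (0:ℝ)..1, |perExt f (x + Int.fract s) - perExt f x|
      ≤ 2 * ∫ x in (0:ℝ)..Int.fract s, perExt f x := integral_abs_shift_le hf h0 hanti hfr0 hfr1
    _ ≤ 2 * (K / (1-α) * (Int.fract s)^(1-α)) := by
        gcongr
        exact integral_perExt_le hf hα1 hK hfr0 hfr1
    _ ≤ 2 * (K / (1-α) * s^(1-α)) := by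
        have h1 : 0 < 1 - α := by linarith
        have : 0 ≤ K / (1-α) := by positivity
        gcongr

lemma integral_abs_shift_le_rpow {f : ℝ → ℝ} (hf : IntegrableOn f (Ioc 0 1))
    (h0 : ∀ x ∈ Ioc (0:ℝ) 1, 0 ≤ f x) (hanti : AntitoneOn f (Ioc 0 1))
    {α K : ℝ} (hα1 : α < 1) (hK0 : 0 ≤ K) (hK : ∀ x ∈ Ioc (0:ℝ) 1, f x ≤ K * x^(-α)) (s : ℝ) :
    ∫ x in (0:ℝ)..1, |perExt f (x + s) - perExt f x| ≤ 2 * (K / (1-α) * |s|^(1-α)) := by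
  rcases le_total 0 s with hs | hs
  · rw [abs_of_nonneg hs]
    exact integral_abs_shift_le_rpow_of_nonneg hf h0 hanti hα1 hK0 hK hs
  · have hper : Function.Periodic (fun y => |perExt f (y + -s) - perExt f y|) 1 := fun y => by
      simp only [add_right_comm y 1 (-s), perExt_periodic f _]
    have h := integral_abs_shift_le_rpow_of_nonneg hf h0 hanti hα1 hK0 hK (neg_nonneg.2 hs)
    rw [abs_of_nonpos hs]
    refine le_trans (le_of_eq ?_) h
    have h1 := hper.intervalIntegral_add_eq s 0
    have h2 := intervalIntegral.integral_comp_add_right (a := 0) (b := 1)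
      (fun y => |perExt f (y + -s) - perExt f y|) s
    rw [zero_add, add_comm 1 s, h1, zero_add] at h2
    rw [← h2]
    refine intervalIntegral.integral_congr fun x _ => ?_
    simp only [add_neg_cancel_right]
    exact abs_sub_comm _ _

lemma L1norm_Aop_sub_le {f : ℝ → ℝ} (hc : ContinuousOn f (Ioc 0 1))
    (hf : IntegrableOn f (Ioc 0 1))
    (h0 : ∀ x ∈ Ioc (0:ℝ) 1, 0 ≤ f x) (hanti : AntitoneOn f (Ioc 0 1))
    {α K : ℝ} (hα1 : α < 1) (hK0 : 0 ≤ K) (hK : ∀ x ∈ Ioc (0:ℝ) 1, f x ≤ K * x^(-α))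
    {ε : ℝ} (hε : 0 < ε) :
    L1norm (fun x => Aop ε f x - f x) ≤ 2 * (K / (1-α) * ε^(1-α)) := by
  have h1α : 0 < 1 - α := by linarith
  have hKα : 0 ≤ K / (1-α) := by positivity
  have hB : 0 ≤ 2 * (K / (1-α) * ε^(1-α)) := by positivity
  have hAf : IntegrableOn (fun x => Aop ε f x - f x) (Ioc 0 1) :=
    ((Aop_continuous hf ε).integrableOn_Ioc).sub hf
  have hmeas : Measurable (Function.uncurry fun x s => ‖perExt f (x + s) - perExt f x‖ₑ) := by
    have := perExt_measurable hc
    unfold Function.uncurry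
    fun_prop
  have hshift : ∀ s ∈ Ioc (-ε) ε, ∫⁻ x in Ioc (0:ℝ) 1, ‖perExt f (x + s) - perExt f x‖ₑ
      ≤ ENNReal.ofReal (2 * (K / (1-α) * ε^(1-α))) := by
    intro s hs
    have hi : IntegrableOn (fun x => perExt f (x + s) - perExt f x) (Ioc 0 1) :=
      (intervalIntegrable_iff_integrableOn_Ioc_of_le zero_le_one).1
        ((perExt_intervalIntegrable_add hf s 0 1).sub (perExt_intervalIntegrable hf 0 1))
    rw [← ofReal_integral_norm_eq_lintegral_enorm hi]
    refine ENNReal.ofReal_le_ofReal ?_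
    have h := integral_abs_shift_le_rpow hf h0 hanti hα1 hK0 hK s
    rw [intervalIntegral.integral_of_le zero_le_one] at h
    refine h.trans ?_
    have : |s| ≤ ε := abs_le.2 ⟨hs.1.le, hs.2⟩
    gcongr
  refine (ENNReal.ofReal_le_ofReal_iff hB).1 ?_
  calc ENNReal.ofReal (L1norm fun x => Aop ε f x - f x)
      = ∫⁻ x in Ioc (0:ℝ) 1, ‖Aop ε f x - f x‖ₑ :=
        ofReal_integral_norm_eq_lintegral_enorm hAf
    _ = ∫⁻ x in Ioo (0:ℝ) 1, ‖Aop ε f x - f x‖ₑ := setLIntegral_congr Ioo_ae_eq_Ioc.symm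
    _ ≤ ∫⁻ x in Ioo (0:ℝ) 1, ENNReal.ofReal (1/(2*ε)) *
          ∫⁻ s in Ioc (-ε) ε, ‖perExt f (x + s) - perExt f x‖ₑ := by
        refine setLIntegral_mono' measurableSet_Ioo fun x hx => ?_
        rw [Aop_sub_eq hf hε hx, enorm_mul, Real.enorm_of_nonneg (by positivity),
          intervalIntegral.integral_of_le (by linarith)]
        gcongr
        exact enorm_integral_le_lintegral_enorm _
    _ = ∫⁻ x in Ioc (0:ℝ) 1, ENNReal.ofReal (1/(2*ε)) *
          ∫⁻ s in Ioc (-ε) ε, ‖perExt f (x + s) - perExt f x‖ₑ :=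
        setLIntegral_congr Ioo_ae_eq_Ioc
    _ = ENNReal.ofReal (1/(2*ε)) *
          ∫⁻ s in Ioc (-ε) ε, ∫⁻ x in Ioc (0:ℝ) 1, ‖perExt f (x + s) - perExt f x‖ₑ := by
        rw [lintegral_const_mul' _ _ ENNReal.ofReal_ne_top,
          lintegral_lintegral_swap hmeas.aemeasurable]
    _ ≤ ENNReal.ofReal (1/(2*ε)) *
          ∫⁻ _ in Ioc (-ε) ε, ENNReal.ofReal (2 * (K / (1-α) * ε^(1-α))) := by
        exact mul_le_mul_of_nonneg_left (setLIntegral_mono' measurableSet_Ioc hshift) bot_le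
    _ = ENNReal.ofReal (2 * (K / (1-α) * ε^(1-α))) := by
        rw [setLIntegral_const, Real.volume_Ioc, ← ENNReal.ofReal_mul hB,
          ← ENNReal.ofReal_mul (by positivity)]
        congr 1
        field_simp
        ring

/-- there is a constant `c > 0`, independent of the `β`'s, such that for
every `f ∈ C₂`, `ε > 0`, `n ≥ 1` and every sequence `β₁, …, β_n ∈ (0,α]`,
`‖P_{β_n} ∘ ⋯ ∘ P_{β_1}(A_ε f) - P_{β_n} ∘ ⋯ ∘ P_{β_1} f‖₁ ≤ c ‖f‖₁ ε^(1-α)`. -/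
theorem averaged_operator_L1_close (α a : ℝ) (hα0 : 0 < α) (hα1 : α < 1)
    (ha : (2:ℝ)^α * (2+α) / (1-α) ≤ a) :
    ∃ c > 0, ∀ f : ℝ → ℝ, memC2 α a f → ∀ ε > 0, ∀ n : ℕ, 1 ≤ n →
      ∀ β : ℕ → ℝ, (∀ i, 1 ≤ i → i ≤ n → β i ∈ Set.Ioc (0:ℝ) α) →
      L1norm (fun x => PopComp β n (Aop ε f) x - PopComp β n f x)
        ≤ c * L1norm f * ε^(1-α) := by
  have h1α : 0 < 1 - α := by linarith
  have ha0 : 0 < a := lt_of_lt_of_le (by positivity) ha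
  refine ⟨2 * a / (1-α), by positivity, ?_⟩
  rintro f ⟨⟨hc, h0, hanti, -⟩, hf, hbd⟩ ε hε n - β hβ
  have hM : mInt f = L1norm f :=
    setIntegral_congr_fun measurableSet_Ioc fun x hx => (abs_of_nonneg (h0 x hx)).symm
  have hM0 : 0 ≤ L1norm f := integral_nonneg fun x => abs_nonneg _
  have hK : ∀ x ∈ Ioc (0:ℝ) 1, f x ≤ a * L1norm f * x^(-α) := fun x hx => by
    have := hbd x hx
    rw [hM] at this
    linarith
  have hAf : IntegrableOn (fun x => Aop ε f x - f x) (Ioc 0 1) :=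
    ((Aop_continuous hf ε).integrableOn_Ioc).sub hf
  rw [← PopComp_sub]
  calc L1norm (PopComp β n fun x => Aop ε f x - f x)
      ≤ L1norm (fun x => Aop ε f x - f x) :=
        (PopComp_L1 (fun i h1 hn => (hβ i h1 hn).1) hAf).2
    _ ≤ 2 * (a * L1norm f / (1-α) * ε^(1-α)) :=
        L1norm_Aop_sub_le hc hf h0 hanti hα1 (by positivity) hK hε
    _ = 2 * a / (1-α) * L1norm f * ε^(1-α) := by ring
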